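/- arXiv:cs/0509001 — 3 statements merged into one kernel-verified Lean document; each statement's English description precedes it below -/
import Mathlib

section
/- Let p > 0, z > 0, and let r be a real number with 0 ≤ r < p. Let g : (0,1] → ℝ satisfy 0 ≤ g(ρ) ≤ p·ρ/(1+ρ) for all ρ ∈ (0,1]. If p·z = sup over ρ ∈ (0,1] of (−ρ·r + g(ρ)), then r = sup over ρ ∈ (0,1] of (−p·z/ρ + g(ρ)/ρ). -/
theorem stmt5 (p z r : ℝ) (hp : 0 < p) (hz : 0 < z) (hr0 : 0 ≤ r) (hrp : r < p)
    (g : ℝ → ℝ) (hg : ∀ ρ ∈ Set.Ioc (0:ℝ) 1, 0 ≤ g ρ ∧ g ρ ≤ p * ρ / (1 + ρ))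
    (h : p * z = sSup {v | ∃ ρ ∈ Set.Ioc (0:ℝ) 1, v = -ρ * r + g ρ}) :
    r = sSup {v | ∃ ρ ∈ Set.Ioc (0:ℝ) 1, v = -(p * z) / ρ + g ρ / ρ} := by
  have hgp : ∀ ρ ∈ Set.Ioc (0:ℝ) 1, g ρ ≤ p * ρ := fun ρ hρ =>
    (hg ρ hρ).2.trans (div_le_self (mul_pos hp hρ.1).le (by linarith [hρ.1]))
  have hbdd : BddAbove {v | ∃ ρ ∈ Set.Ioc (0:ℝ) 1, v = -ρ * r + g ρ} := by
    refine ⟨p, ?_⟩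
    rintro _ ⟨ρ, hρ, rfl⟩
    nlinarith [hgp ρ hρ, mul_nonneg hρ.1.le hr0, mul_le_mul_of_nonneg_left hρ.2 hp.le]
  have hone : (1:ℝ) ∈ Set.Ioc (0:ℝ) 1 := by norm_num
  symm
  refine csSup_eq_of_forall_le_of_forall_lt_exists_gt ⟨_, 1, hone, rfl⟩ ?_ ?_
  · rintro _ ⟨ρ, hρ, rfl⟩
    have hle : -ρ * r + g ρ ≤ p * z := h ▸ le_csSup hbdd ⟨ρ, hρ, rfl⟩
    rw [← add_div, div_le_iff₀ hρ.1]
    linarith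
  · intro w hw
    have hlt : max (p * z / 2) (p * z - (r - w) * (z / 2)) <
        sSup {v | ∃ ρ ∈ Set.Ioc (0:ℝ) 1, v = -ρ * r + g ρ} := by
      rw [← h]
      have := mul_pos hp hz
      have := mul_pos (sub_pos.2 hw) (half_pos hz)
      exact max_lt (by linarith) (by linarith)
    obtain ⟨_, ⟨ρ, hρ, rfl⟩, hv⟩ := exists_lt_of_lt_csSup (by exact ⟨_, 1, hone, rfl⟩) hlt
    obtain ⟨hhalf, hnear⟩ := max_lt_iff.1 hv
    -- A value above `p * z / 2` forces `ρ` away from `0`.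
    have hzρ : z / 2 < ρ := by
      have := hgp ρ hρ
      have := mul_nonneg hρ.1.le hr0
      exact lt_of_mul_lt_mul_left (by linarith : p * (z / 2) < p * ρ) hp.le
    refine ⟨_, ⟨ρ, hρ, rfl⟩, ?_⟩
    rw [← add_div, lt_div_iff₀ hρ.1]
    linarith [mul_lt_mul_of_pos_left hzρ (sub_pos.2 hw)]
end

section
/- Let 0 < z < 1/4 and set ρ* = √z/(1−√z) ∈ (0,1). Let F : (0,∞) × (0,1] → ℝ and S : (0,1] → ℝ be such that the function ρ ↦ S(ρ)/ρ is continuous and bounded on (0,1] (with a continuous bounded extension to [0,1]), and suppose that (F(p,ρ)/(p·ρ) − 1/(1+ρ))/p → S(ρ)/(2ρ) uniformly in ρ ∈ (0,1] as p → 0⁺. Define r(p) = sup over ρ ∈ (0,1] of (−p·z/ρ + F(p,ρ)/ρ). Then lim_{p→0⁺} (r(p) − p·(1−√z)²)/(p²/2) = S(ρ*)/ρ*. -/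
open Filter

/-- Completing the square in the leading-order objective. -/
theorem neg_div_add_one_div_eq (s ρ : ℝ) (hρ : 0 < ρ) :
    -s ^ 2 / ρ + 1 / (1 + ρ) = (1 - s) ^ 2 - ((1 - s) * ρ - s) ^ 2 / (ρ * (1 + ρ)) := by
  have : (1 + ρ) ≠ 0 := by positivity
  field_simp
  ring

theorem stmt7 (z : ℝ) (hz1 : 0 < z) (hz2 : z < 1 / 4)
    (ρstar : ℝ) (hρstar : ρstar = Real.sqrt z / (1 - Real.sqrt z))
    (F : ℝ → ℝ → ℝ) (S : ℝ → ℝ) (Sbar : ℝ → ℝ)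
    (hScont : ContinuousOn Sbar (Set.Icc (0:ℝ) 1))
    (hSbdd : ∃ M : ℝ, ∀ ρ ∈ Set.Icc (0:ℝ) 1, |Sbar ρ| ≤ M)
    (hSagree : ∀ ρ ∈ Set.Ioc (0:ℝ) 1, Sbar ρ = S ρ / ρ)
    (hconv : ∀ ε > 0, ∃ δ > 0, ∀ p : ℝ, 0 < p → p < δ → ∀ ρ ∈ Set.Ioc (0:ℝ) 1,
      |(F p ρ / (p * ρ) - 1 / (1 + ρ)) / p - S ρ / (2 * ρ)| < ε) :
    Tendsto (fun p : ℝ =>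
        ((sSup {v | ∃ ρ ∈ Set.Ioc (0:ℝ) 1, v = -(p * z) / ρ + F p ρ / ρ}) -
          p * (1 - Real.sqrt z) ^ 2) / (p ^ 2 / 2))
      (nhdsWithin 0 (Set.Ioi 0)) (nhds (S ρstar / ρstar)) := by
  set s := Real.sqrt z with hs
  have hs0 : 0 < s := Real.sqrt_pos.2 hz1
  have hsz : s ^ 2 = z := Real.sq_sqrt hz1.le
  have hs1 : s < 1 / 2 := by nlinarith
  have hmem : ρstar ∈ Set.Ioc (0 : ℝ) 1 := by
    rw [hρstar]
    exact ⟨div_pos hs0 (by linarith), (div_le_one (by linarith)).2 (by linarith)⟩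
  have hstar : (1 - s) * ρstar = s := by
    rw [hρstar]
    exact mul_div_cancel₀ s (by linarith)
  obtain ⟨M, hM⟩ := hSbdd
  have hmem' := Set.Ioc_subset_Icc_self hmem
  rw [← hSagree ρstar hmem, Metric.tendsto_nhdsWithin_nhds]
  intro ε hε
  obtain ⟨δ, hδ, hF⟩ := hconv (ε / 8) (by positivity)
  obtain ⟨η, hη, hcont⟩ := Metric.continuousOn_iff.1 hScont ρstar hmem' (ε / 8) (by positivity)
  have hM0 : 0 ≤ M := (abs_nonneg _).trans (hM ρstar hmem')
  set c := (1 - s) ^ 2 * η ^ 2 with hc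
  have hc0 : 0 < c := by
    have : 0 < 1 - s := by linarith
    positivity
  refine ⟨min δ (c / (2 * M + 1)), by positivity, ?_⟩
  intro p hp hpd
  have hp0 : 0 < p := hp
  rw [Real.dist_eq, sub_zero, abs_of_pos hp0, lt_min_iff, lt_div_iff₀ (by positivity)] at hpd
  obtain ⟨hpδ, hpc⟩ := hpd
  have expand : ∀ ρ ∈ Set.Ioc (0 : ℝ) 1, ∃ e, |e| < ε / 8 ∧
      -(p * z) / ρ + F p ρ / ρ = p * (1 - s) ^ 2
        + (p ^ 2 / 2 * (Sbar ρ + 2 * e) - p * (((1 - s) * ρ - s) ^ 2 / (ρ * (1 + ρ)))) := by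
    intro ρ hρ
    have hρ0 : 0 < ρ := hρ.1
    refine ⟨_, hF p hp0 hpδ ρ hρ, ?_⟩
    have h := neg_div_add_one_div_eq s ρ hρ0
    have h1 : ((1 - s) * ρ - s) ^ 2 / (ρ * (1 + ρ))
        = (1 - s) ^ 2 - (-s ^ 2 / ρ + 1 / (1 + ρ)) := by linarith
    have : (1 + ρ) ≠ 0 := by positivity
    rw [h1, hsz, hSagree ρ hρ]
    field_simp
    ring
  have upper : ∀ v ∈ {v | ∃ ρ ∈ Set.Ioc (0 : ℝ) 1, v = -(p * z) / ρ + F p ρ / ρ},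
      v ≤ p * (1 - s) ^ 2 + p ^ 2 / 2 * (Sbar ρstar + ε / 2) := by
    rintro v ⟨ρ, hρ, rfl⟩
    obtain ⟨e, he, hv⟩ := expand ρ hρ
    rw [hv]
    have hρ0 : 0 < ρ := hρ.1
    have hρ1 : ρ ≤ 1 := hρ.2
    have he' := abs_lt.1 he
    have hρ' := Set.Ioc_subset_Icc_self hρ
    have hp2 : 0 < p ^ 2 / 2 := by positivity
    by_cases hd : dist ρ ρstar < η
    · have h1 := (abs_lt.1 (hcont ρ hρ' hd)).2
      have h2 : 0 ≤ p * (((1 - s) * ρ - s) ^ 2 / (ρ * (1 + ρ))) := by positivity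
      have h3 := mul_le_mul_of_nonneg_left
        (show Sbar ρ + 2 * e ≤ Sbar ρstar + ε / 2 by linarith [he'.2]) hp2.le
      linarith
    · have h1 : η ^ 2 ≤ (ρ - ρstar) ^ 2 := by
        rw [← sq_abs (ρ - ρstar), ← Real.dist_eq]
        exact pow_le_pow_left₀ hη.le (not_lt.1 hd) 2
      have h2 : c ≤ ((1 - s) * ρ - s) ^ 2 := by
        have : ((1 - s) * ρ - s) ^ 2 = (1 - s) ^ 2 * (ρ - ρstar) ^ 2 := by
          rw [← mul_pow, mul_sub, hstar]
        rw [this, hc]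
        gcongr
      have h3 : c / 2 ≤ ((1 - s) * ρ - s) ^ 2 / (ρ * (1 + ρ)) := by
        gcongr
        nlinarith
      have h4 := mul_le_mul_of_nonneg_left h3 hp0.le
      have h5 : p * (p * (2 * M + 1)) ≤ p * c := mul_le_mul_of_nonneg_left hpc.le hp0.le
      have h6 := (abs_le.1 (hM ρ hρ')).2
      have h7 := (abs_le.1 (hM ρstar hmem')).1
      have h8 := mul_le_mul_of_nonneg_left
        (show Sbar ρ + 2 * e ≤ Sbar ρstar + ε / 2 + (2 * M + 1) by linarith [he'.2]) hp2.le
      linarith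
  have lower : p * (1 - s) ^ 2 + p ^ 2 / 2 * (Sbar ρstar - ε / 2) ≤
      sSup {v | ∃ ρ ∈ Set.Ioc (0 : ℝ) 1, v = -(p * z) / ρ + F p ρ / ρ} := by
    refine le_trans ?_ (le_csSup ⟨_, upper⟩ ⟨ρstar, hmem, rfl⟩)
    obtain ⟨e, he, hv⟩ := expand ρstar hmem
    have he' := abs_lt.1 he
    rw [hv, hstar, sub_self, zero_pow two_ne_zero, zero_div, mul_zero, sub_zero]
    gcongr
    linarith [he'.1]
  have hsup := csSup_le (by exact ⟨_, ρstar, hmem, rfl⟩) upper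
  rw [Real.dist_eq, abs_lt]
  have hp2 : 0 < p ^ 2 / 2 := by positivity
  constructor
  · rw [lt_sub_iff_add_lt, lt_div_iff₀ hp2]
    nlinarith [mul_pos hp2 hε]
  · rw [sub_lt_iff_lt_add, div_lt_iff₀ hp2]
    nlinarith [mul_pos hp2 hε]
end

section
/- For every real t ≥ −1 and every ρ ∈ [0,1], (1+t)^{1+ρ} ≥ 1 + (1+ρ)·t + (ρ(1+ρ)/2)·t² + (ρ(1+ρ)(ρ−1)/6)·t³. -/
theorem one_add_mul_self_le_rpow_one_add_of_mem_Icc_neg_one_zero {s p : ℝ} (hs : -1 < s)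
    (hp : p ∈ Set.Icc (-1 : ℝ) 0) : 1 + p * s ≤ (1 + s) ^ p := by
  have hpos : 0 < (1 + s) ^ (-p) := Real.rpow_pos_of_pos (by linarith) _
  have hinv : (1 + s) ^ p * (1 + s) ^ (-p) = 1 := by
    rw [← Real.rpow_add (by linarith)]
    simp
  have hle : (1 + s) ^ (-p) ≤ 1 + -p * s :=
    rpow_one_add_le_one_add_mul_self hs.le (by linarith [hp.2]) (by linarith [hp.1])
  have hle' : (1 + p * s) * (1 + -p * s) ≤ 1 := by nlinarith [sq_nonneg (p * s)]
  have hpos' : 0 < (1 + s) ^ p := Real.rpow_pos_of_pos (by linarith) _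
  have : 1 ≤ (1 + s) ^ p * (1 + -p * s) :=
    hinv.symm.le.trans (mul_le_mul_of_nonneg_left hle hpos'.le)
  exact le_of_mul_le_mul_right (hle'.trans this) (hpos.trans_le hle)

theorem hasDerivAt_one_add_rpow {s : ℝ} (hs : -1 < s) (p : ℝ) :
    HasDerivAt (fun t : ℝ => (1 + t) ^ p) (p * (1 + s) ^ (p - 1)) s := by
  have h := ((hasDerivAt_id s).const_add 1).rpow_const (p := p)
    (Or.inl (by simp only [id]; linarith : (1 + id s) ≠ 0))
  simpa using h

theorem ConvexOn.le_of_hasDerivAt_zero {S : Set ℝ} {f : ℝ → ℝ} {x y : ℝ}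
    (hf : ConvexOn ℝ S f) (hx : x ∈ S) (hy : y ∈ S) (hd : HasDerivAt f 0 x) : f x ≤ f y := by
  rcases lt_trichotomy x y with h | rfl | h
  · have := hf.le_slope_of_hasDerivAt hx hy h hd
    rw [slope_def_field, le_div_iff₀ (sub_pos.2 h)] at this
    linarith
  · exact le_rfl
  · have := hf.slope_le_of_hasDerivAt hy hx h hd
    rw [slope_def_field, div_le_iff₀ (sub_pos.2 h)] at this
    linarith

theorem stmt15 (t ρ : ℝ) (ht : -1 ≤ t) (hρ : ρ ∈ Set.Icc (0:ℝ) 1) :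
    1 + (1 + ρ) * t + (ρ * (1 + ρ) / 2) * t ^ 2 + (ρ * (1 + ρ) * (ρ - 1) / 6) * t ^ 3 ≤
      (1 + t) ^ (1 + ρ) := by
  obtain ⟨hρ0, hρ1⟩ := hρ
  set f : ℝ → ℝ := fun s => (1 + s) ^ (1 + ρ) - (1 + (1 + ρ) * s +
    (ρ * (1 + ρ) / 2) * s ^ 2 + (ρ * (1 + ρ) * (ρ - 1) / 6) * s ^ 3) with hf
  set f' : ℝ → ℝ := fun s => (1 + ρ) * ((1 + s) ^ ρ - (1 + ρ * s +
    (ρ * (ρ - 1) / 2) * s ^ 2)) with hf'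
  set f'' : ℝ → ℝ := fun s => (1 + ρ) * ρ * ((1 + s) ^ (ρ - 1) - (1 + (ρ - 1) * s)) with hf''
  have hpoly (a b c s : ℝ) : HasDerivAt (fun s : ℝ => 1 + a * s + b * s ^ 2 + c * s ^ 3)
      (a + 2 * b * s + 3 * c * s ^ 2) s := by
    have h := ((((hasDerivAt_id s).const_mul a).const_add 1).add
      ((hasDerivAt_pow 2 s).const_mul b)).add ((hasDerivAt_pow 3 s).const_mul c)
    refine h.congr_deriv ?_
    norm_num
    ring
  have hd (s : ℝ) (hs : -1 < s) : HasDerivAt f (f' s) s := by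
    refine ((hasDerivAt_one_add_rpow hs (1 + ρ)).sub (hpoly _ _ _ s)).congr_deriv ?_
    rw [hf', add_sub_cancel_left]
    ring
  have hd' (s : ℝ) (hs : -1 < s) : HasDerivAt f' (f'' s) s := by
    have h := ((hasDerivAt_one_add_rpow hs ρ).sub
      (hpoly ρ (ρ * (ρ - 1) / 2) 0 s)).const_mul (1 + ρ)
    simp only [Pi.sub_apply, zero_mul, add_zero, mul_zero] at h
    refine h.congr_deriv ?_
    rw [hf'']
    ring
  have hconv : ConvexOn ℝ (Set.Ici (-1)) f := by
    refine convexOn_of_hasDerivWithinAt2_nonneg (f' := f') (f'' := f'') (convex_Ici _) ?_ ?_ ?_ ?_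
    · refine ContinuousOn.sub ?_ (by fun_prop)
      exact ((continuous_const.add continuous_id).rpow_const
        fun _ => Or.inr (by linarith)).continuousOn
    all_goals
      intro s hs
      rw [interior_Ici, Set.mem_Ioi] at hs
    · exact (hd s hs).hasDerivWithinAt
    · exact (hd' s hs).hasDerivWithinAt
    · exact mul_nonneg (by positivity) (sub_nonneg.2
        (one_add_mul_self_le_rpow_one_add_of_mem_Icc_neg_one_zero hs
          ⟨by linarith, by linarith⟩))
  have hd0 : HasDerivAt f 0 0 := by simpa [hf'] using hd 0 (by norm_num)
  have h := hconv.le_of_hasDerivAt_zero (by norm_num) ht hd0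
  have h0 : f 0 = 0 := by simp [hf]
  rw [h0] at h
  exact sub_nonneg.1 h
end
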